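/- arXiv:1205.3007 — 2 statements merged into one kernel-verified Lean document; each statement's English description precedes it below -/
import Mathlib

section
/- Let R be a commutative noetherian ring, let Λ be a ring containing R as a subring of its center such that Λ is finitely generated as an R-module, let P be a prime two-sided ideal of Λ, and let p = P ∩ R. Let I be a nonzero indecomposable injective right Λ-module containing a nonzero submodule N₀ such that every nonzero submodule of N₀ has annihilator equal to P. Then the submodule N = {x ∈ I : xa = 0 for all a ∈ P} of I is nonzero, every element of R ∖ p acts bijectively on N, so that N carries a natural structure of right Λ_p-module, and N is simple as a right Λ_p-module. -/
universe u v

open scoped TensorProduct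

/-- The annihilator of a right `Λ`-module (i.e. a `Λᵐᵒᵖ`-module) `S`, as a two-sided ideal of
`Λ`: it consists of all `a : Λ` with `S • a = 0`. -/
def rightAnnihilator (Λ : Type u) [Ring Λ] (S : Type v) [AddCommGroup S]
    [Module Λᵐᵒᵖ S] : TwoSidedIdeal Λ :=
  TwoSidedIdeal.mk' {a : Λ | ∀ x : S, MulOpposite.op a • x = 0}
    (fun x => by simp)
    (fun {a b} ha hb x => by
      rw [Set.mem_setOf_eq] at ha hb
      rw [MulOpposite.op_add, add_smul, ha x, hb x, add_zero])
    (fun {a} ha x => by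
      rw [Set.mem_setOf_eq] at ha
      rw [MulOpposite.op_neg, neg_smul, ha x, neg_zero])
    (fun {a b} hb x => by
      rw [Set.mem_setOf_eq] at hb
      rw [MulOpposite.op_mul, mul_smul]; exact hb _)
    (fun {a b} ha x => by
      rw [Set.mem_setOf_eq] at ha
      rw [MulOpposite.op_mul, mul_smul, ha x, smul_zero])

/-- A two-sided ideal `P` of `Λ` is *prime* if it is proper and `a Λ b ⊆ P` implies `a ∈ P` or
`b ∈ P`. -/
def IsPrimeTwoSided {Λ : Type u} [Ring Λ] (P : TwoSidedIdeal Λ) : Prop :=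
  P ≠ ⊤ ∧ ∀ a b : Λ, (∀ x : Λ, a * x * b ∈ P) → a ∈ P ∨ b ∈ P

/-- A two-sided ideal of `Λ` is *maximal* if it is a maximal element of the set of proper
two-sided ideals of `Λ`. -/
def IsMaximalTwoSided {Λ : Type u} [Ring Λ] (P : TwoSidedIdeal Λ) : Prop :=
  P ≠ ⊤ ∧ ∀ Q : TwoSidedIdeal Λ, P < Q → Q = ⊤

/-- A two-sided ideal of `Λ`, viewed as a submodule of `Λ` as a right module over itself. -/
def TwoSidedIdeal.toRightSubmodule {Λ : Type u} [Ring Λ] (P : TwoSidedIdeal Λ) :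
    Submodule Λᵐᵒᵖ Λ where
  carrier := P
  zero_mem' := P.zero_mem
  add_mem' := P.add_mem
  smul_mem' := fun c x hx => by
    rw [MulOpposite.smul_eq_mul_unop]
    exact P.mul_mem_right _ _ hx

/-- The central localization `Λ_p = Λ ⊗_R R_p` of an `R`-algebra `Λ` at a prime ideal `p` of
`R`. -/
noncomputable abbrev LocalizedAlg (R : Type u) [CommRing R] (Λ : Type u) [Ring Λ] [Algebra R Λ]
    (p : Ideal R) [p.IsPrime] : Type u :=
  Localization.AtPrime p ⊗[R] Λ

/-- The canonical ring homomorphism `φ : Λ → Λ_p`. -/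
noncomputable abbrev localizationRingHom (R : Type u) [CommRing R] (Λ : Type u) [Ring Λ]
    [Algebra R Λ] (p : Ideal R) [p.IsPrime] : Λ →+* LocalizedAlg R Λ p :=
  (Algebra.TensorProduct.includeRight (R := R) (A := Localization.AtPrime p) (B := Λ)).toRingHom


/-- The contraction `P ∩ R` of a two-sided ideal of `Λ` to the central subring `R`. -/
def TwoSidedIdeal.contract (R : Type u) [CommRing R] (Λ : Type u) [Ring Λ] [Algebra R Λ]
    (P : TwoSidedIdeal Λ) : Ideal R :=
  Ideal.comap (algebraMap R Λ) (TwoSidedIdeal.asIdeal (R := Λ) P)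

/-- A module is *indecomposable* if it is nonzero and is not the direct sum of two nonzero
submodules. -/
def IsIndecomposableModule (A : Type u) [Ring A] (M : Type v) [AddCommGroup M] [Module A M] :
    Prop :=
  Nontrivial M ∧
    ¬ ∃ N₁ N₂ : Submodule A M, N₁ ≠ ⊥ ∧ N₂ ≠ ⊥ ∧ N₁ ⊓ N₂ = ⊥ ∧ N₁ ⊔ N₂ = ⊤

/-- The set `N = {x ∈ I : xa = 0 for all a ∈ P}`, as a submodule of the right `Λ`-module
`I`. -/
def annSubmodule (Λ : Type u) [Ring Λ] (I : Type v) [AddCommGroup I] [Module Λᵐᵒᵖ I]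
    (P : TwoSidedIdeal Λ) : Submodule Λᵐᵒᵖ I where
  carrier := {x : I | ∀ a ∈ P, MulOpposite.op a • x = 0}
  zero_mem' := fun a _ => smul_zero _
  add_mem' := fun {x y} hx hy a ha => by
    rw [smul_add, hx a ha, hy a ha, add_zero]
  smul_mem' := fun c x hx a ha => by
    have h1 : MulOpposite.op a * c = MulOpposite.op (c.unop * a) := by
      rw [MulOpposite.op_mul, MulOpposite.op_unop]
    rw [smul_smul, h1]
    exact hx _ (P.mul_mem_left c.unop a ha)

theorem exists_maximal_disjoint {A M : Type*} [Ring A] [AddCommGroup M] [Module A M]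
    (X Y : Submodule A M) (h : Disjoint X Y) :
    ∃ Z, Y ≤ Z ∧ Maximal (Disjoint X) Z := by
  refine zorn_le_nonempty₀ {Z | Disjoint X Z} (fun c hc hchain y hy => ?_) Y h
  exact ⟨sSup c, (hchain.directedOn.disjoint_sSup_right).2 fun Z hZ => hc hZ,
    fun Z hZ => le_sSup hZ⟩

/-- An indecomposable injective module is uniform. -/
theorem IsIndecomposableModule.inf_ne_bot {A : Type u} [Ring A] {I : Type u} [AddCommGroup I]
    [Module A I] [Module.Injective A I] (hI : IsIndecomposableModule A I)
    {X Y : Submodule A I} (hX : X ≠ ⊥) (hY : Y ≠ ⊥) : X ⊓ Y ≠ ⊥ := by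
  intro hXY
  obtain ⟨Z, hYZ, hZ⟩ := exists_maximal_disjoint X Y (disjoint_iff.2 hXY)
  obtain ⟨E, hXE, hE⟩ := exists_maximal_disjoint Z X hZ.prop.symm
  have hZE : Disjoint Z E := hE.prop
  let f : E × Z →ₗ[A] I := E.subtype.coprod Z.subtype
  have hf : Function.Injective f := by
    rw [← LinearMap.ker_eq_bot, LinearMap.ker_coprod_of_disjoint_range]
    · simp
    · simpa using hZE.symm
  obtain ⟨h, hh⟩ := Module.Injective.out f hf (E.subtype ∘ₗ LinearMap.fst A E Z)
  have hhE : ∀ e ∈ E, h e = e := fun e he => by simpa [f] using hh (⟨e, he⟩, 0)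
  have hhZ : ∀ z ∈ Z, h z = 0 := fun z hz => by simpa [f] using hh (0, ⟨z, hz⟩)
  have hker : h.ker = Z := by
    refine le_antisymm (hZ.le_of_ge ?_ fun z hz => hhZ z hz) fun z hz => hhZ z hz
    rw [Submodule.disjoint_def]
    exact fun x hx hx' => (hhE x (hXE hx)).symm.trans hx'
  have hEr : E ≤ h.range := fun e he => ⟨e, hhE e he⟩
  have hrange : h.range = E := by
    refine le_antisymm (hE.le_of_ge ?_ hEr) hEr
    rw [Submodule.disjoint_def]
    rintro _ hx ⟨i, rfl⟩
    by_contra hne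
    have hi : i ∉ Z := fun hi => hne (hhZ i hi)
    have hlt : Z < Z ⊔ A ∙ i :=
      lt_of_le_of_ne le_sup_left fun heq => hi (heq ▸ Submodule.mem_sup_right
        (Submodule.mem_span_singleton_self i))
    have hnd : ¬ Disjoint X (Z ⊔ A ∙ i) := fun hd => hlt.not_ge (hZ.le_of_ge hd hlt.le)
    rw [Submodule.disjoint_def] at hnd
    push Not at hnd
    obtain ⟨x, hxX, hxs, hx0⟩ := hnd
    obtain ⟨z, hz, w, hw, rfl⟩ := Submodule.mem_sup.1 hxs
    obtain ⟨a, rfl⟩ := Submodule.mem_span_singleton.1 hw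
    have h1 := hhE _ (hXE hxX)
    rw [map_add, hhZ z hz, zero_add, map_smul] at h1
    exact hx0 (Submodule.disjoint_def.1 hZE _ (h1 ▸ Z.smul_mem a hx) (hXE hxX))
  refine hI.2 ⟨E, Z, fun h => hX (le_bot_iff.1 (h ▸ hXE)), fun h => hY (le_bot_iff.1 (h ▸ hYZ)),
    hZE.symm.eq_bot, ?_⟩
  rw [eq_top_iff]
  intro x _
  have hx : h x ∈ E := hrange ▸ ⟨x, rfl⟩
  rw [← add_sub_cancel (h x) x]
  refine Submodule.add_mem_sup hx (hker ▸ ?_)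
  rw [LinearMap.mem_ker, map_sub, hhE _ hx, sub_self]

/-- A uniform module over an artinian ring, all of whose nonzero submodules have the same
annihilator, is simple. -/
theorem isSimpleModule_of_uniform {C M : Type*} [Ring C] [IsArtinianRing C] [AddCommGroup M]
    [Module C M] [Nontrivial M]
    (huniform : ∀ X Y : Submodule C M, X ≠ ⊥ → Y ≠ ⊥ → X ⊓ Y ≠ ⊥)
    (hann : ∀ T : Submodule C M, T ≠ ⊥ → ∀ c : C, (∀ t ∈ T, c • t = 0) → ∀ x : M, c • x = 0) :
    IsSimpleModule C M := by
  obtain ⟨y, hy⟩ := exists_ne (0 : M)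
  obtain ⟨S', hS'⟩ : ∃ S : Submodule C (C ∙ y), IsAtom S := by
    have : Nontrivial (C ∙ y) := Submodule.nontrivial_span_singleton hy
    have := isArtinian_of_fg_of_artinian (C ∙ y) (Submodule.fg_span_singleton y)
    exact IsAtomic.exists_atom _
  obtain ⟨S, hS⟩ : ∃ S : Submodule C M, IsSimpleModule C S := by
    have := isSimpleModule_iff_isAtom.2 hS'
    exact ⟨S'.map (C ∙ y).subtype, IsSimpleModule.congr
      (Submodule.equivSubtypeMap _ S').symm⟩
  have hS0 : S ≠ ⊥ := (isSimpleModule_iff_isAtom.1 hS).1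
  obtain ⟨t, ht⟩ := Finset.exists_inf_le fun s : S => (LinearMap.toSpanSingleton C S s).ker
  let φ : C →ₗ[C] (t → S) := LinearMap.pi fun s => LinearMap.toSpanSingleton C S s
  have hss : IsSemisimpleModule C (C ⧸ φ.ker) :=
    IsSemisimpleModule.congr φ.quotKerEquivRange
  suffices S = ⊤ by
    subst this
    exact IsSimpleModule.congr Submodule.topEquiv.symm
  rw [eq_top_iff]
  intro x _
  have hφx : φ.ker ≤ (LinearMap.toSpanSingleton C M x).ker := by
    intro c hc
    rw [LinearMap.mem_ker, LinearMap.toSpanSingleton_apply]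
    refine hann S hS0 c (fun s hs => ?_) x
    have hct : c ∈ t.inf fun s : S => (LinearMap.toSpanSingleton C S s).ker := by
      rw [Submodule.mem_finsetInf]
      intro i hi
      exact congrFun (LinearMap.mem_ker.1 hc) ⟨i, hi⟩
    simpa using congrArg Subtype.val (LinearMap.mem_ker.1 (ht ⟨s, hs⟩ hct))
  let g := φ.ker.liftQ _ hφx
  have hgx : x ∈ g.range := ⟨Submodule.Quotient.mk 1, by simp [g]⟩
  have := IsSemisimpleModule.range g
  obtain ⟨X, hX⟩ := exists_isCompl (S.comap g.range.subtype)
  have hX0 : X.map g.range.subtype = ⊥ := by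
    by_contra hne
    refine huniform _ _ hS0 hne ?_
    rw [← disjoint_iff, Submodule.disjoint_def]
    rintro _ hxS ⟨z, hz, rfl⟩
    simpa using Submodule.disjoint_def.1 hX.disjoint z hxS hz
  replace hX0 : X = ⊥ := Submodule.map_injective_of_injective (Submodule.injective_subtype _)
    (hX0.trans (Submodule.map_bot _).symm)
  have htop : (⟨x, hgx⟩ : g.range) ∈ S.comap g.range.subtype := by
    have := hX.sup_eq_top
    rw [hX0, sup_bot_eq] at this
    rw [this]
    trivial
  exact htop

theorem exists_smul_eq_one_tmul {R B : Type*} [CommRing R] [Ring B] [Algebra R B]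
    (p : Ideal R) [p.IsPrime] (c : p.ResidueField ⊗[R] B) :
    ∃ s ∉ p, ∃ b : B, s • c = 1 ⊗ₜ b := by
  induction c with
  | zero => exact ⟨1, p.one_notMem, 0, by simp⟩
  | tmul k b =>
    obtain ⟨r, s, hs, rfl⟩ := IsFractionRing.div_surjective (A := R ⧸ p) k
    obtain ⟨r, rfl⟩ := Ideal.Quotient.mk_surjective r
    obtain ⟨s, rfl⟩ := Ideal.Quotient.mk_surjective s
    have hs : s ∉ p := fun h => nonZeroDivisors.ne_zero hs (Ideal.Quotient.eq_zero_iff_mem.2 h)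
    refine ⟨s, hs, r • b, ?_⟩
    have hs' : algebraMap R p.ResidueField s ≠ 0 := by
      rwa [Ne, Ideal.algebraMap_residueField_eq_zero]
    rw [TensorProduct.tmul_smul, TensorProduct.smul_tmul', TensorProduct.smul_tmul']
    congr 1
    rw [Algebra.smul_def, Algebra.smul_def, mul_one, Ideal.algebraMap_quotient_residueField_mk,
      Ideal.algebraMap_quotient_residueField_mk, mul_div_cancel₀ _ hs']
  | add c d hc hd =>
    obtain ⟨s, hs, a, ha⟩ := hc
    obtain ⟨t, ht, b, hb⟩ := hd
    refine ⟨s * t, fun h => (Ideal.IsPrime.mem_or_mem ‹_› h).elim hs ht, t • a + s • b, ?_⟩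
    rw [smul_add, TensorProduct.tmul_add, TensorProduct.tmul_smul, TensorProduct.tmul_smul, ← ha,
      ← hb, smul_smul, smul_smul, mul_comm t s]

/-- The residue field of `p` acts on a module killed by `p` on which the elements outside `p` act
bijectively. -/
noncomputable def residueFieldToEnd {R A M : Type*} [CommRing R] [Ring A] [Algebra R A]
    [AddCommGroup M] [Module R M] [Module A M] [IsScalarTower R A M] (p : Ideal R) [p.IsPrime]
    (hp : ∀ r ∈ p, ∀ x : M, r • x = 0)
    (hs : ∀ s ∉ p, Function.Bijective fun x : M => s • x) :
    p.ResidueField →ₐ[R] Subalgebra.center R (Module.End A M) :=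
  Ideal.ResidueField.liftₐ p (Algebra.ofId R _)
    (fun r hr => Subtype.ext <| LinearMap.ext fun x => hp r hr x)
    (fun s h => by
      have hu : IsUnit (algebraMap R (Module.End A M) s) :=
        (Module.End.isUnit_iff _).2 (hs s h)
      obtain ⟨u, hu⟩ := hu
      have hc : (↑u⁻¹ : Module.End A M) ∈ Subalgebra.center R (Module.End A M) := by
        rw [Subalgebra.mem_center_iff]
        intro b
        have : Commute b (u : Module.End A M) := hu ▸ (Algebra.commutes s b).symm
        exact this.units_inv_right
      refine IsUnit.of_mul_eq_one (⟨_, hc⟩ : Subalgebra.center R (Module.End A M))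
        (Subtype.ext ?_)
      change algebraMap R (Module.End A M) s * ↑u⁻¹ = 1
      rw [← hu, Units.mul_inv])

theorem exists_isSimpleModule_residueField_tensorProduct {R A M : Type*} [CommRing R] [Ring A]
    [Algebra R A] [Module.Finite R A] [AddCommGroup M] [Module R M] [Module A M]
    [IsScalarTower R A M] [Nontrivial M] (p : Ideal R) [p.IsPrime]
    (hp : ∀ r ∈ p, ∀ x : M, r • x = 0)
    (hs : ∀ s ∉ p, Function.Bijective fun x : M => s • x)
    (huniform : ∀ X Y : Submodule A M, X ≠ ⊥ → Y ≠ ⊥ → X ⊓ Y ≠ ⊥)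
    (hann : ∀ T : Submodule A M, T ≠ ⊥ → ∀ a : A, (∀ t ∈ T, a • t = 0) → ∀ x : M, a • x = 0) :
    ∃ _ : Module (p.ResidueField ⊗[R] A) M,
      (∀ (a : A) (x : M), ((1 : p.ResidueField) ⊗ₜ[R] a) • x = a • x) ∧
      IsSimpleModule (p.ResidueField ⊗[R] A) M := by
  let ψ := residueFieldToEnd (A := A) p hp hs
  let : Module p.ResidueField M :=
    Module.compHom M ((Subalgebra.val _).comp ψ).toRingHom
  have hψ : ∀ (k : p.ResidueField) (x : M), k • x = (ψ k : Module.End A M) x := fun _ _ => rfl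
  have : IsScalarTower R p.ResidueField M := ⟨fun r k x => by
    rw [hψ, hψ, map_smul]; rfl⟩
  have : SMulCommClass p.ResidueField A M := ⟨fun k a x => by rw [hψ, hψ, map_smul]⟩
  let : Module (p.ResidueField ⊗[R] A) M := TensorProduct.Algebra.module
  have hone : ∀ (a : A) (x : M), ((1 : p.ResidueField) ⊗ₜ[R] a) • x = a • x := fun a x => by
    rw [TensorProduct.Algebra.smul_def, one_smul]
  have hR : ∀ (r : R) (c : p.ResidueField ⊗[R] A) (x : M), (r • c) • x = r • (c • x) := by
    intro r c x
    rw [Algebra.smul_def, mul_smul, Algebra.TensorProduct.algebraMap_apply,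
      TensorProduct.Algebra.smul_def, one_smul, algebraMap_smul]
  have : IsArtinianRing (p.ResidueField ⊗[R] A) := IsArtinianRing.of_finite p.ResidueField _
  let toA (X : Submodule (p.ResidueField ⊗[R] A) M) : Submodule A M :=
    { X.toAddSubmonoid with smul_mem' := fun a x hx => hone a x ▸ X.smul_mem _ hx }
  have htoA : ∀ X, X ≠ ⊥ → toA X ≠ ⊥ := fun X hX h => hX <| (Submodule.eq_bot_iff _).2
    fun x hx => (Submodule.eq_bot_iff _).1 h x hx
  refine ⟨inferInstance, hone, isSimpleModule_of_uniform (fun X Y hX hY h => ?_) ?_⟩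
  · refine huniform _ _ (htoA X hX) (htoA Y hY) ((Submodule.eq_bot_iff _).2 fun x hx => ?_)
    exact (Submodule.eq_bot_iff _).1 h x hx
  · intro T hT c hc x
    obtain ⟨s, hsp, a, hsa⟩ := exists_smul_eq_one_tmul p c
    have ha : ∀ x : M, a • x = s • (c • x) := fun x => by rw [← hone, ← hsa, hR]
    apply (hs s hsp).1
    change s • (c • x) = s • 0
    rw [smul_zero, ← ha]
    exact hann (toA T) (htoA T hT) a (fun t ht => by rw [ha, hc t ht, smul_zero]) x

/-- The canonical surjection from the opposite of `R_p ⊗ Λ` to `κ(p) ⊗ Λᵐᵒᵖ`. -/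
noncomputable def localizedAlgOpToResidueField (R : Type u) [CommRing R] (Λ : Type u) [Ring Λ]
    [Algebra R Λ] (p : Ideal R) [p.IsPrime] :
    (LocalizedAlg R Λ p)ᵐᵒᵖ →ₐ[R] p.ResidueField ⊗[R] Λᵐᵒᵖ :=
  (Algebra.TensorProduct.map
    ((IsScalarTower.toAlgHom R (Localization.AtPrime p) p.ResidueField).comp
      (AlgEquiv.toOpposite R (Localization.AtPrime p)).symm.toAlgHom)
    (AlgHom.id R Λᵐᵒᵖ)).comp
      (Algebra.TensorProduct.opAlgEquiv R R (Localization.AtPrime p) Λ).symm.toAlgHom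

theorem localizedAlgOpToResidueField_surjective (R : Type u) [CommRing R] (Λ : Type u) [Ring Λ]
    [Algebra R Λ] (p : Ideal R) [p.IsPrime] :
    Function.Surjective (localizedAlgOpToResidueField R Λ p) := by
  rw [localizedAlgOpToResidueField, AlgHom.coe_comp]
  refine Function.Surjective.comp (TensorProduct.map_surjective ?_ Function.surjective_id)
    (Algebra.TensorProduct.opAlgEquiv R R (Localization.AtPrime p) Λ).symm.surjective
  intro k
  obtain ⟨r, rfl⟩ := IsLocalRing.residue_surjective k
  exact ⟨MulOpposite.op r, rfl⟩

theorem localizedAlgOpToResidueField_op (R : Type u) [CommRing R] (Λ : Type u) [Ring Λ]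
    [Algebra R Λ] (p : Ideal R) [p.IsPrime] (a : Λ) :
    localizedAlgOpToResidueField R Λ p (MulOpposite.op (localizationRingHom R Λ p a)) =
      1 ⊗ₜ MulOpposite.op a := by
  simp [localizedAlgOpToResidueField]

theorem mem_rightAnnihilator {Λ : Type u} [Ring Λ] {S : Type v} [AddCommGroup S]
    [Module Λᵐᵒᵖ S] {a : Λ} :
    a ∈ rightAnnihilator Λ S ↔ ∀ x : S, MulOpposite.op a • x = 0 := by
  rw [rightAnnihilator, TwoSidedIdeal.mem_mk', Set.mem_ofPred_eq]

/-- An element which is left regular modulo `P` acts surjectively on the elements killed by `P`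
in an injective module. -/
theorem exists_op_smul_eq_of_mem_annSubmodule {Λ : Type u} [Ring Λ] {I : Type u} [AddCommGroup I]
    [Module Λᵐᵒᵖ I] [Module.Injective Λᵐᵒᵖ I] {P : TwoSidedIdeal Λ} {s : Λ}
    (hsP : ∀ a, s * a ∈ P → a ∈ P) {x : I}
    (hx : x ∈ annSubmodule Λ I P) :
    ∃ y ∈ annSubmodule Λ I P, MulOpposite.op s • y = x := by
  let L : Λ →ₗ[Λᵐᵒᵖ] Λ :=
    { toFun := fun a => s * a
      map_add' := mul_add s
      map_smul' := fun c a => by simp [MulOpposite.smul_eq_mul_unop, mul_assoc] }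
  let g : Λ →ₗ[Λᵐᵒᵖ] I :=
    { toFun := fun a => MulOpposite.op a • x
      map_add' := fun a b => by rw [MulOpposite.op_add, add_smul]
      map_smul' := fun c a => by
        simp [MulOpposite.smul_eq_mul_unop, mul_smul] }
  let f := P.toRightSubmodule.mapQ P.toRightSubmodule L fun a ha => P.mul_mem_left s a ha
  have hfmk : ∀ a : Λ, f (Submodule.Quotient.mk a) = Submodule.Quotient.mk (s * a) := fun _ => rfl
  have hf : Function.Injective f := by
    rw [← LinearMap.ker_eq_bot, Submodule.eq_bot_iff]
    intro q hq
    obtain ⟨a, rfl⟩ := Submodule.Quotient.mk_surjective _ q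
    rw [LinearMap.mem_ker, hfmk, Submodule.Quotient.mk_eq_zero] at hq
    exact (Submodule.Quotient.mk_eq_zero _).2 (hsP a hq)
  obtain ⟨h, hh⟩ := Module.Injective.out f hf (P.toRightSubmodule.liftQ g fun a ha => hx a ha)
  have hmk : ∀ a : Λ, MulOpposite.op a • h (Submodule.Quotient.mk 1) =
      h (Submodule.Quotient.mk a) := fun a => by
    rw [← map_smul, ← Submodule.Quotient.mk_smul, MulOpposite.smul_eq_mul_unop,
      MulOpposite.unop_op, one_mul]
  refine ⟨h (Submodule.Quotient.mk 1), fun a ha => ?_, ?_⟩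
  · rw [hmk, (Submodule.Quotient.mk_eq_zero _).2 ha, map_zero]
  · rw [hmk, ← mul_one s, ← hfmk, hh]
    exact one_smul _ x

/-- Let `P` be a prime two-sided ideal of a noetherian `R`-algebra `Λ` and `p = P ∩ R`.  If `I`
is a nonzero indecomposable injective right `Λ`-module containing a nonzero submodule `N₀` all
of whose nonzero submodules have annihilator `P`, then `N = {x ∈ I : xP = 0}` is nonzero,
every `s ∈ R ∖ p` acts bijectively on `N`, `N` carries a natural right `Λ_p`-module structure,
and `N` is a simple right `Λ_p`-module. -/
theorem annSubmodule_simple_over_localization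
    (R : Type u) [CommRing R] [IsNoetherianRing R]
    (Λ : Type u) [Ring Λ] [Algebra R Λ]
    (hRcenter : Function.Injective (algebraMap R Λ)) [Module.Finite R Λ]
    (P : TwoSidedIdeal Λ) (hP : IsPrimeTwoSided P)
    (p : Ideal R) (hp : p.IsPrime) (hPp : TwoSidedIdeal.contract R Λ P = p)
    (I : Type u) [AddCommGroup I] [Module Λᵐᵒᵖ I] [Module.Injective Λᵐᵒᵖ I]
    (hI : IsIndecomposableModule Λᵐᵒᵖ I)
    (N₀ : Submodule Λᵐᵒᵖ I) (hN₀ : N₀ ≠ ⊥)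
    (hN₀ann : ∀ N' : Submodule Λᵐᵒᵖ N₀, N' ≠ ⊥ → rightAnnihilator Λ N' = P) :
    annSubmodule Λ I P ≠ ⊥ ∧
    (∀ s : R, s ∉ p →
      Function.Bijective (fun x : annSubmodule Λ I P =>
        (⟨MulOpposite.op (algebraMap R Λ s) • (x : I),
          (annSubmodule Λ I P).smul_mem _ x.2⟩ : annSubmodule Λ I P))) ∧
    ∃ _ : Module (LocalizedAlg R Λ p)ᵐᵒᵖ (annSubmodule Λ I P),
      (∀ (a : Λ) (x : annSubmodule Λ I P),
          MulOpposite.op (localizationRingHom R Λ p a) • x = MulOpposite.op a • x) ∧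
      IsSimpleModule (LocalizedAlg R Λ p)ᵐᵒᵖ (annSubmodule Λ I P) := by
  set N := annSubmodule Λ I P
  have hN₀N : N₀ ≤ N := by
    intro x hx a ha
    have hne : (⊤ : Submodule Λᵐᵒᵖ N₀) ≠ ⊥ := by
      have := (Submodule.nontrivial_iff_ne_bot).2 hN₀
      exact top_ne_bot
    rw [← hN₀ann ⊤ hne, mem_rightAnnihilator] at ha
    exact congrArg (fun z : (⊤ : Submodule Λᵐᵒᵖ N₀) => ((z : N₀) : I)) (ha ⟨⟨x, hx⟩, trivial⟩)
  have hNbot : N ≠ ⊥ := fun h => hN₀ (le_bot_iff.1 (h ▸ hN₀N))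
  have huniform : ∀ X Y : Submodule Λᵐᵒᵖ N, X ≠ ⊥ → Y ≠ ⊥ → X ⊓ Y ≠ ⊥ := by
    intro X Y hX hY h
    have hinj := Submodule.map_injective_of_injective N.injective_subtype
    refine hI.inf_ne_bot (X := X.map N.subtype) (Y := Y.map N.subtype)
      (fun h => hX (hinj (h.trans (Submodule.map_bot _).symm)))
      (fun h => hY (hinj (h.trans (Submodule.map_bot _).symm))) ?_
    rw [← Submodule.map_inf _ N.injective_subtype, h, Submodule.map_bot]
  have hmem : ∀ T : Submodule Λᵐᵒᵖ N, T ≠ ⊥ → ∀ a : Λ,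
      (∀ t ∈ T, MulOpposite.op a • t = 0) → a ∈ P := by
    intro T hT a ha
    have hT' : T.map N.subtype ≠ ⊥ := fun h => hT
      (Submodule.map_injective_of_injective N.injective_subtype
        (h.trans (Submodule.map_bot _).symm))
    have hne : (T.map N.subtype).comap N₀.subtype ≠ ⊥ := by
      intro h
      refine hI.inf_ne_bot hN₀ hT' ?_
      rw [← Submodule.map_comap_subtype, h, Submodule.map_bot]
    rw [← hN₀ann _ hne, mem_rightAnnihilator]
    rintro ⟨⟨x, hx₀⟩, t, ht, htx⟩
    ext
    change MulOpposite.op a • x = 0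
    rw [show x = t from htx.symm]
    exact congrArg Subtype.val (ha t ht)
  have hp_mem : ∀ r : R, r ∈ p ↔ algebraMap R Λ r ∈ P := fun r => by
    rw [← hPp]
    simp [TwoSidedIdeal.contract]
  have hbij : ∀ s : R, s ∉ p → Function.Bijective (fun x : N =>
      (⟨MulOpposite.op (algebraMap R Λ s) • (x : I), N.smul_mem _ x.2⟩ : N)) := by
    intro s hs
    refine ⟨?_, ?_⟩
    · have hcomm : ∀ c : Λᵐᵒᵖ, c * MulOpposite.op (algebraMap R Λ s) =
          MulOpposite.op (algebraMap R Λ s) * c := fun c => (Algebra.commutes s c).symm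
      let l : N →ₗ[Λᵐᵒᵖ] N :=
        { toFun := fun x => MulOpposite.op (algebraMap R Λ s) • x
          map_add' := smul_add _
          map_smul' := fun c x => by
            rw [RingHom.id_apply, smul_smul, smul_smul, hcomm] }
      have hl : l.ker = ⊥ := by
        by_contra hne
        exact hs ((hp_mem s).2 (hmem _ hne _ fun t ht => ht))
      exact LinearMap.ker_eq_bot.1 hl
    · rintro ⟨x, hx⟩
      obtain ⟨y, hy, hyx⟩ := exists_op_smul_eq_of_mem_annSubmodule (s := algebraMap R Λ s)
        (fun a ha => ((hP.2 (algebraMap R Λ s) a fun z => by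
          rw [Algebra.commutes, mul_assoc]
          exact P.mul_mem_left _ _ ha).resolve_left fun h => hs ((hp_mem s).2 h))) hx
      exact ⟨⟨y, hy⟩, Subtype.ext hyx⟩
  refine ⟨hNbot, hbij, ?_⟩
  let : Module R N := Module.compHom N (algebraMap R Λᵐᵒᵖ)
  have : IsScalarTower R Λᵐᵒᵖ N := IsScalarTower.of_compHom R Λᵐᵒᵖ N
  have : Nontrivial N := Submodule.nontrivial_iff_ne_bot.2 hNbot
  have : Module.Finite R Λᵐᵒᵖ := Module.Finite.equiv (MulOpposite.opLinearEquiv R)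
  have hP_smul : ∀ a ∈ P, ∀ x : N, MulOpposite.op a • x = 0 :=
    fun a ha x => Subtype.ext (x.2 a ha)
  obtain ⟨mod, hone, hsimple⟩ := exists_isSimpleModule_residueField_tensorProduct
    (A := Λᵐᵒᵖ) (M := N) p
    (fun r hr x => hP_smul _ ((hp_mem r).1 hr) x) hbij huniform
    (fun T hT a ha => hP_smul a.unop (hmem T hT a.unop ha))
  let θ := (localizedAlgOpToResidueField R Λ p).toRingHom
  have hθ : Function.Surjective θ := localizedAlgOpToResidueField_surjective R Λ p
  let mod' : Module (LocalizedAlg R Λ p)ᵐᵒᵖ N := Module.compHom N θ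
  refine ⟨mod', fun a x => ?_, ?_⟩
  · exact (congrArg (· • x) (localizedAlgOpToResidueField_op R Λ p a)).trans (hone _ x)
  · have : RingHomSurjective θ := ⟨hθ⟩
    let e : N →ₛₗ[θ] N :=
      { toFun := id
        map_add' := fun _ _ => rfl
        map_smul' := fun _ _ => rfl }
    exact (LinearMap.isSimpleModule_iff_of_bijective e Function.bijective_id).2 hsimple
end

section
/- Let R be a commutative noetherian ring, let Λ be a ring containing R as a subring of its center such that Λ is finitely generated as an R-module, let P be a prime two-sided ideal of Λ, and let p = P ∩ R. Then the quotient ring Λ_p/PΛ_p is a nonzero simple artinian ring, i.e. it is artinian and has no two-sided ideals other than 0 and itself. -/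
universe u v

open scoped TensorProduct

section PrimeRing

variable {A : Type*} [Ring A]

/-- The Jacobson radical of an artinian ring in which `a A b = 0` implies `a = 0` or `b = 0`
vanishes. -/
theorem jacobson_eq_bot_of_prime [IsArtinianRing A]
    (h : ∀ a b : A, (∀ x, a * x * b = 0) → a = 0 ∨ b = 0) : Ring.jacobson A = ⊥ := by
  obtain ⟨n, hn⟩ := IsSemiprimaryRing.isNilpotent (R := A)
  have key : ∀ n : ℕ, (Ring.jacobson A) ^ (n + 1) = ⊥ → Ring.jacobson A = ⊥ := by
    intro n
    induction n with
    | zero => intro h1; rwa [zero_add, Submodule.pow_one] at h1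
    | succ n ih =>
      intro h1
      by_contra hne
      obtain ⟨b, hb, hb0⟩ := Submodule.exists_mem_ne_zero_of_ne_bot hne
      refine hne (ih ((Submodule.eq_bot_iff _).2 fun a ha => ?_))
      refine (h a b fun x => ?_).resolve_right hb0
      have hmem : a * (x * b) ∈ (Ring.jacobson A) ^ (n + 1 + 1) := by
        rw [Submodule.pow_succ]
        exact Ideal.mul_mem_mul ha (Ideal.mul_mem_left _ x hb)
      rw [h1] at hmem
      rw [mul_assoc]
      simpa using hmem
  refine key n ?_
  rw [Submodule.pow_succ, hn, zero_mul]
  rfl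

/-- A nontrivial artinian ring in which `a A b = 0` implies `a = 0` or `b = 0` is simple. -/
theorem isSimpleRing_of_prime [Nontrivial A] [IsArtinianRing A]
    (h : ∀ a b : A, (∀ x, a * x * b = 0) → a = 0 ∨ b = 0) : IsSimpleRing A := by
  refine (isSimpleRing_isArtinianRing_iff.mpr
    ⟨IsArtinianRing.isSemisimpleRing_iff_jacobson.mpr (jacobson_eq_bot_of_prime h),
      fun L hL N hN => ?_, inferInstance⟩).1
  obtain ⟨l, hl, hl0⟩ := Submodule.exists_mem_ne_zero_of_ne_bot (isSimpleModule_iff_isAtom.1 hL).1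
  obtain ⟨n, hn, hn0⟩ := Submodule.exists_mem_ne_zero_of_ne_bot (isSimpleModule_iff_isAtom.1 hN).1
  obtain ⟨x, hx⟩ : ∃ x, n * x * l ≠ 0 := by
    by_contra! hc
    exact (h n l hc).elim hn0 hl0
  let f : N →ₗ[A] L := (LinearMap.toSpanSingleton A L ⟨x * l, L.smul_mem x hl⟩).comp N.subtype
  have hf : f ≠ 0 := fun h0 => hx <| by
    have h1 := congrArg Subtype.val (LinearMap.congr_fun h0 ⟨n, hn⟩)
    simpa [f, mul_assoc] using h1
  exact ⟨.ofBijective f (LinearMap.bijective_of_ne_zero hf)⟩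

end PrimeRing

/-- A finite algebra over a local ring that is annihilated by the maximal ideal is artinian. -/
theorem isArtinianRing_of_finite_of_maximalIdeal_eq_zero (K A : Type*) [CommRing K] [IsLocalRing K]
    [Ring A] [Algebra K A] [Module.Finite K A]
    (h : ∀ a ∈ IsLocalRing.maximalIdeal K, algebraMap K A a = 0) : IsArtinianRing A := by
  have ht : Module.IsTorsionBySet K A (IsLocalRing.maximalIdeal K : Set K) := by
    rintro x ⟨a, ha⟩
    change a • x = 0
    rw [Algebra.smul_def, h a ha, zero_mul]
  let := ht.module
  let : Field (K ⧸ IsLocalRing.maximalIdeal K) := Ideal.Quotient.field _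
  have : IsScalarTower K (K ⧸ IsLocalRing.maximalIdeal K) A := ht.isScalarTower
  have : Module.Finite (K ⧸ IsLocalRing.maximalIdeal K) A := .of_restrictScalars_finite K _ _
  have : IsScalarTower (K ⧸ IsLocalRing.maximalIdeal K) A A := ⟨fun c x y => by
    obtain ⟨c, rfl⟩ := Ideal.Quotient.mk_surjective c
    exact smul_mul_assoc c x y⟩
  exact .of_finite (K ⧸ IsLocalRing.maximalIdeal K) A

section Localization

variable {R Λ Λ' : Type*} [CommRing R] [Ring Λ] [Algebra R Λ] [Ring Λ'] [Algebra R Λ']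

theorem TwoSidedIdeal.algebra_smul_mem (P : TwoSidedIdeal Λ) (r : R) {x : Λ} (hx : x ∈ P) :
    r • x ∈ P := by
  rw [Algebra.smul_def]
  exact P.mul_mem_left _ _ hx

variable (M : Submonoid R) (f : Λ →ₐ[R] Λ') [IsLocalizedModule M f.toLinearMap]

/-- Every element of the extension of a two-sided ideal to a central localization is a fraction
with numerator in the ideal. -/
theorem TwoSidedIdeal.exists_smul_eq_of_mem_span_image (P : TwoSidedIdeal Λ) {z : Λ'}
    (hz : z ∈ TwoSidedIdeal.span (f '' P)) : ∃ s ∈ M, ∃ a ∈ P, s • z = f a := by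
  let J : TwoSidedIdeal Λ' := TwoSidedIdeal.mk' {z | ∃ s ∈ M, ∃ a ∈ P, s • z = f a}
    ⟨1, M.one_mem, 0, P.zero_mem, by simp⟩
    (by
      rintro x y ⟨s, hs, a, ha, h1⟩ ⟨t, ht, b, hb, h2⟩
      refine ⟨s * t, M.mul_mem hs ht, t • a + s • b,
        P.add_mem (P.algebra_smul_mem t ha) (P.algebra_smul_mem s hb), ?_⟩
      rw [map_add, map_smul, map_smul, ← h1, ← h2, smul_add, smul_smul, smul_smul, mul_comm t s])
    (by
      rintro x ⟨s, hs, a, ha, h1⟩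
      exact ⟨s, hs, -a, P.neg_mem ha, by rw [smul_neg, h1, map_neg]⟩)
    (by
      rintro x y ⟨s, hs, a, ha, h1⟩
      obtain ⟨⟨c, t⟩, h2⟩ := IsLocalizedModule.surj M f.toLinearMap x
      refine ⟨t * s, M.mul_mem t.2 hs, c * a, P.mul_mem_left _ _ ha, ?_⟩
      have h2 : (t : R) • x = f c := h2
      rw [map_mul, ← h1, ← h2, smul_mul_smul_comm])
    (by
      rintro x y ⟨s, hs, a, ha, h1⟩
      obtain ⟨⟨c, t⟩, h2⟩ := IsLocalizedModule.surj M f.toLinearMap y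
      refine ⟨s * t, M.mul_mem hs t.2, a * c, P.mul_mem_right _ _ ha, ?_⟩
      have h2 : (t : R) • y = f c := h2
      rw [map_mul, ← h1, ← h2, smul_mul_smul_comm])
  have hle : TwoSidedIdeal.span (f '' P) ≤ J := TwoSidedIdeal.span_le.2 <| by
    rintro _ ⟨a, ha, rfl⟩
    rw [SetLike.mem_coe, TwoSidedIdeal.mem_mk']
    exact ⟨1, M.one_mem, a, ha, one_smul _ _⟩
  have hzJ : z ∈ J := hle hz
  rw [TwoSidedIdeal.mem_mk'] at hzJ
  exact hzJ

/-- A two-sided ideal that is saturated with respect to `M` is the contraction of its extension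
to the central localization at `M`. -/
theorem TwoSidedIdeal.map_mem_span_image_iff (P : TwoSidedIdeal Λ)
    (hP : ∀ s ∈ M, ∀ a : Λ, s • a ∈ P → a ∈ P) {a : Λ} :
    f a ∈ TwoSidedIdeal.span (f '' P) ↔ a ∈ P := by
  refine ⟨fun h => ?_, fun h => TwoSidedIdeal.subset_span ⟨a, h, rfl⟩⟩
  obtain ⟨s, hs, b, hb, h1⟩ := TwoSidedIdeal.exists_smul_eq_of_mem_span_image M f P h
  obtain ⟨t, ht⟩ := IsLocalizedModule.exists_of_eq (S := M) (f := f.toLinearMap)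
    (x₁ := s • a) (x₂ := b) (by simpa using h1)
  refine hP s hs a (hP t t.2 _ ?_)
  have ht : (t : R) • s • a = (t : R) • b := ht
  rw [ht]
  exact P.algebra_smul_mem _ hb

/-- For a two-sided ideal saturated with respect to `M`, a fraction lies in the extension if and
only if its numerator lies in the ideal. -/
theorem TwoSidedIdeal.mem_span_image_iff (P : TwoSidedIdeal Λ)
    (hP : ∀ s ∈ M, ∀ a : Λ, s • a ∈ P → a ∈ P) {z : Λ'} {s : R} (hs : s ∈ M) {a : Λ}
    (h : s • z = f a) : z ∈ TwoSidedIdeal.span (f '' P) ↔ a ∈ P := by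
  rw [← TwoSidedIdeal.map_mem_span_image_iff M f P hP, ← h]
  refine ⟨fun hz => TwoSidedIdeal.algebra_smul_mem _ s hz, fun hz => ?_⟩
  obtain ⟨⟨c, t⟩, h1⟩ := IsLocalizedModule.surj M f.toLinearMap z
  obtain ⟨w, hw⟩ := ((Module.End.isUnit_iff _).1
    (IsLocalizedModule.map_units f.toLinearMap ⟨s, hs⟩)).2 1
  have hw : s • w = 1 := hw
  have : z = w * (s • z) := by rw [mul_smul_comm, ← smul_mul_assoc, hw, one_mul]
  rw [this]
  exact TwoSidedIdeal.mul_mem_left _ _ _ hz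

/-- The extension of a saturated prime two-sided ideal to a central localization is prime. -/
theorem IsPrimeTwoSided.span_image {P : TwoSidedIdeal Λ} (hP : IsPrimeTwoSided P)
    (hs : ∀ s ∈ M, ∀ a : Λ, s • a ∈ P → a ∈ P) :
    IsPrimeTwoSided (TwoSidedIdeal.span (f '' P)) := by
  refine ⟨fun h => hP.1 ?_, fun z w hzw => ?_⟩
  · refine eq_top_iff.2 fun a _ => (TwoSidedIdeal.map_mem_span_image_iff M f P hs).1 ?_
    rw [h]
    trivial
  · obtain ⟨⟨a, s⟩, h1⟩ := IsLocalizedModule.surj M f.toLinearMap z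
    obtain ⟨⟨b, t⟩, h2⟩ := IsLocalizedModule.surj M f.toLinearMap w
    have h1 : (s : R) • z = f a := h1
    have h2 : (t : R) • w = f b := h2
    rw [TwoSidedIdeal.mem_span_image_iff M f P hs s.2 h1,
      TwoSidedIdeal.mem_span_image_iff M f P hs t.2 h2]
    refine hP.2 a b fun x => ?_
    rw [← TwoSidedIdeal.map_mem_span_image_iff M f P hs, map_mul, map_mul, ← h1, ← h2,
      smul_mul_assoc, smul_mul_smul_comm]
    exact TwoSidedIdeal.algebra_smul_mem _ _ (hzw _)

end Localization

theorem TwoSidedIdeal.mk'_eq_zero_iff {A : Type*} [Ring A] (J : TwoSidedIdeal A) (x : A) :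
    J.ringCon.mk' x = 0 ↔ x ∈ J := by
  rw [← TwoSidedIdeal.mem_ker, TwoSidedIdeal.ker_ringCon_mk']

/-- The quotient of a finite algebra over `R_p` by a prime two-sided ideal containing `p` is a
simple artinian ring. -/
theorem IsPrimeTwoSided.quotient_simple_artinian {R S : Type*} [CommRing R] {p : Ideal R}
    [p.IsPrime] [Ring S] [Algebra R S] [Algebra (Localization.AtPrime p) S]
    [IsScalarTower R (Localization.AtPrime p) S] [Module.Finite (Localization.AtPrime p) S]
    {J : TwoSidedIdeal S} (hJ : IsPrimeTwoSided J) (hpJ : ∀ r ∈ p, algebraMap R S r ∈ J) :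
    Nontrivial J.ringCon.Quotient ∧ IsSimpleRing J.ringCon.Quotient ∧
      IsArtinianRing J.ringCon.Quotient := by
  have hnt : Nontrivial J.ringCon.Quotient := by
    refine ⟨1, 0, fun h => hJ.1 (eq_top_iff.2 fun x _ => ?_)⟩
    rw [← map_one J.ringCon.mk', J.mk'_eq_zero_iff] at h
    simpa using J.mul_mem_left x 1 h
  have hart : IsArtinianRing J.ringCon.Quotient := by
    have : Module.Finite (Localization.AtPrime p) J.ringCon.Quotient :=
      .of_surjective
        ({ J.ringCon.mk' with map_smul' := fun _ _ => rfl } :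
          S →ₗ[Localization.AtPrime p] J.ringCon.Quotient)
        J.ringCon.mk'_surjective
    refine isArtinianRing_of_finite_of_maximalIdeal_eq_zero (Localization.AtPrime p) _
      fun a ha => ?_
    change J.ringCon.mk' (algebraMap _ S a) = 0
    rw [J.mk'_eq_zero_iff]
    rw [← Localization.AtPrime.map_eq_maximalIdeal] at ha
    suffices h : p.map (algebraMap R (Localization.AtPrime p)) ≤
        (TwoSidedIdeal.asIdeal J).comap (algebraMap _ S) from h ha
    refine Ideal.map_le_iff_le_comap.2 fun r hr => ?_
    have h := hpJ r hr
    rwa [IsScalarTower.algebraMap_apply R (Localization.AtPrime p)] at h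
  refine ⟨hnt, isSimpleRing_of_prime fun a b hab => ?_, hart⟩
  obtain ⟨a, rfl⟩ := J.ringCon.mk'_surjective a
  obtain ⟨b, rfl⟩ := J.ringCon.mk'_surjective b
  rw [J.mk'_eq_zero_iff, J.mk'_eq_zero_iff]
  refine hJ.2 a b fun x => ?_
  rw [← J.mk'_eq_zero_iff, map_mul, map_mul]
  exact hab _

/-- A prime two-sided ideal is saturated with respect to the complement of its contraction. -/
theorem IsPrimeTwoSided.mem_of_smul_mem {R Λ : Type*} [CommRing R] [Ring Λ] [Algebra R Λ]
    {P : TwoSidedIdeal Λ} (hP : IsPrimeTwoSided P) {s : R} (hs : algebraMap R Λ s ∉ P) {a : Λ}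
    (ha : s • a ∈ P) : a ∈ P := by
  refine (hP.2 (algebraMap R Λ s) a fun x => ?_).resolve_left hs
  rw [Algebra.commutes, mul_assoc, ← Algebra.smul_def]
  exact P.mul_mem_left _ _ ha

/-- Let `P` be a prime two-sided ideal of a noetherian `R`-algebra `Λ` and `p = P ∩ R`.  Then
the quotient ring `Λ_p / PΛ_p` is a nonzero simple artinian ring: it is artinian and has no
two-sided ideals other than `0` and itself. -/
theorem localization_quotient_simple_artinian
    (R : Type u) [CommRing R] [IsNoetherianRing R]
    (Λ : Type u) [Ring Λ] [Algebra R Λ]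
    (hRcenter : Function.Injective (algebraMap R Λ)) [Module.Finite R Λ]
    (P : TwoSidedIdeal Λ) (hP : IsPrimeTwoSided P)
    (p : Ideal R) (hp : p.IsPrime) (hPp : TwoSidedIdeal.contract R Λ P = p) :
    Nontrivial
      (TwoSidedIdeal.span (localizationRingHom R Λ p '' P)).ringCon.Quotient ∧
    IsSimpleRing
      (TwoSidedIdeal.span (localizationRingHom R Λ p '' P)).ringCon.Quotient ∧
    IsArtinianRing
      (TwoSidedIdeal.span (localizationRingHom R Λ p '' P)).ringCon.Quotient := by
  let f : Λ →ₐ[R] LocalizedAlg R Λ p :=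
    Algebra.TensorProduct.includeRight (R := R) (A := Localization.AtPrime p) (B := Λ)
  have : IsLocalizedModule p.primeCompl f.toLinearMap :=
    inferInstanceAs
      (IsLocalizedModule p.primeCompl (TensorProduct.mk R (Localization.AtPrime p) Λ 1))
  have hmem : ∀ r : R, algebraMap R Λ r ∈ P ↔ r ∈ p := fun r => by
    rw [← hPp]
    exact Iff.rfl
  have hsat : ∀ s ∈ p.primeCompl, ∀ a : Λ, s • a ∈ P → a ∈ P := fun s hs a ha =>
    hP.mem_of_smul_mem (fun h => hs ((hmem s).1 h)) ha
  change Nontrivial (TwoSidedIdeal.span (f '' P)).ringCon.Quotient ∧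
    IsSimpleRing (TwoSidedIdeal.span (f '' P)).ringCon.Quotient ∧
    IsArtinianRing (TwoSidedIdeal.span (f '' P)).ringCon.Quotient
  have hJ := hP.span_image p.primeCompl f hsat
  have hpJ : ∀ r ∈ p, algebraMap R (LocalizedAlg R Λ p) r ∈ TwoSidedIdeal.span (f '' P) :=
    fun r hr => by
      rw [← f.commutes]
      exact TwoSidedIdeal.subset_span ⟨_, (hmem r).2 hr, rfl⟩
  exact hJ.quotient_simple_artinian hpJ
end
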